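/- For any invertible n×n matrices φ, ψ over A: p₃((φᵀ)⁻¹)(τ₁,τ₂,τ₃) = p₃(φ)(τ₁,τ₂,τ₃) for all τ₁,τ₂,τ₃ ∈ Der, and P₂((φᵀ)⁻¹, (ψᵀ)⁻¹)(τ,σ) = P₂(φ,ψ)(τ,σ) for all τ,σ ∈ Der. (Section 3.5: p(φ) = p(φ^{−1,t}), so the Pontryagin–Atiyah–Chern–Simons class satisfies p(E) = p(E*).) -/

import Mathlib

noncomputable section

variable (k A : Type*) [Field k] [CharZero k] [CommRing A] [Algebra k A]

/-- Entrywise application of a derivation to a matrix. -/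
def dmat {n : ℕ} (τ : Derivation k A A) (φ : Matrix (Fin n) (Fin n) A) :
    Matrix (Fin n) (Fin n) A :=
  Matrix.of fun p q => τ (φ p q)

/-- One half, as an element of `A`. -/
def half : A := algebraMap k A 2⁻¹

/-- `P₂(φ,ψ)(τ,σ) := ½[tr(ψ⁻¹φ⁻¹τ(φ)σ(ψ)) − tr(ψ⁻¹φ⁻¹σ(φ)τ(ψ))]`,
the 2-form `½ tr{ψ⁻¹φ⁻¹ dφ dψ}` evaluated on `(τ,σ)`. -/
def P2 {n : ℕ} (φ ψ : Matrix (Fin n) (Fin n) A) (τ σ : Derivation k A A) : A :=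
  half k A * (Matrix.trace (ψ⁻¹ * φ⁻¹ * dmat k A τ φ * dmat k A σ ψ)
    - Matrix.trace (ψ⁻¹ * φ⁻¹ * dmat k A σ φ * dmat k A τ ψ))

/-- `p₃(φ)(τ₁,τ₂,τ₃) := (1/6)·Σ_{π∈S₃} sgn(π)·tr(N_{π(1)} N_{π(2)} N_{π(3)})`
with `N_i = φ⁻¹·τ_i(φ)`; the 3-form `(1/6)tr{(φ⁻¹dφ)³}` evaluated on `(τ₁,τ₂,τ₃)`. -/
def p3 {n : ℕ} (φ : Matrix (Fin n) (Fin n) A) (τ₁ τ₂ τ₃ : Derivation k A A) : A :=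
  algebraMap k A 6⁻¹ *
    ∑ π : Equiv.Perm (Fin 3), (Equiv.Perm.sign π : ℤ) •
      Matrix.trace ((φ⁻¹ * dmat k A (![τ₁, τ₂, τ₃] (π 0)) φ) *
        (φ⁻¹ * dmat k A (![τ₁, τ₂, τ₃] (π 1)) φ) *
        (φ⁻¹ * dmat k A (![τ₁, τ₂, τ₃] (π 2)) φ))

/-- The cochain `p₂(φ,g)` of Section 3.5 (with `g = g_i`, `h = g_j`), evaluated on `(τ,σ)`. -/
def Qc {n : ℕ} (φ g h : Matrix (Fin n) (Fin n) A) (τ σ : Derivation k A A) : A :=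
  half k A * (Matrix.trace (φ⁻¹ * g⁻¹ * dmat k A τ g * φ * h⁻¹ * dmat k A σ h)
    - Matrix.trace (φ⁻¹ * g⁻¹ * dmat k A σ g * φ * h⁻¹ * dmat k A τ h)
    + Matrix.trace (φ⁻¹ * dmat k A τ φ * h⁻¹ * dmat k A σ h)
    - Matrix.trace (φ⁻¹ * dmat k A σ φ * h⁻¹ * dmat k A τ h)
    - Matrix.trace (g⁻¹ * dmat k A τ g * dmat k A σ φ * φ⁻¹)
    + Matrix.trace (g⁻¹ * dmat k A σ g * dmat k A τ φ * φ⁻¹))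

section

variable {K B : Type*} [Field K] [CommRing B] [Algebra K B] {n : ℕ}

lemma dmat_mul (τ : Derivation K B B) (φ ψ : Matrix (Fin n) (Fin n) B) :
    dmat K B τ (φ * ψ) = dmat K B τ φ * ψ + φ * dmat K B τ ψ := by
  ext i j
  simp only [dmat, Matrix.of_apply, Matrix.mul_apply, Matrix.add_apply, map_sum,
    Derivation.leibniz, smul_eq_mul, ← Finset.sum_add_distrib]
  exact Finset.sum_congr rfl fun _ _ => by ring

lemma dmat_one (τ : Derivation K B B) :
    dmat K B τ (1 : Matrix (Fin n) (Fin n) B) = 0 := by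
  ext i j
  by_cases h : i = j <;> simp [dmat, Matrix.one_apply, h]

lemma dmat_transpose (τ : Derivation K B B) (φ : Matrix (Fin n) (Fin n) B) :
    dmat K B τ φ.transpose = (dmat K B τ φ).transpose :=
  rfl

lemma dmat_inv (τ : Derivation K B B) {φ : Matrix (Fin n) (Fin n) B} (hφ : IsUnit φ) :
    dmat K B τ φ⁻¹ = -(φ⁻¹ * dmat K B τ φ * φ⁻¹) := by
  have hdet := (Matrix.isUnit_iff_isUnit_det φ).mp hφ
  have h := dmat_mul τ φ φ⁻¹
  rw [Matrix.mul_nonsing_inv φ hdet, dmat_one] at h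
  calc dmat K B τ φ⁻¹ = φ⁻¹ * (φ * dmat K B τ φ⁻¹) := by
        rw [Matrix.nonsing_inv_mul_cancel_left _ _ hdet]
    _ = -(φ⁻¹ * dmat K B τ φ * φ⁻¹) := by
        rw [eq_neg_of_add_eq_zero_right h.symm, mul_neg, mul_assoc]

/-- The logarithmic derivative of the inverse transpose. -/
lemma inv_mul_dmat_inv_transpose (τ : Derivation K B B) {φ : Matrix (Fin n) (Fin n) B}
    (hφ : IsUnit φ) :
    (φ.transpose⁻¹)⁻¹ * dmat K B τ φ.transpose⁻¹ = -(φ⁻¹ * dmat K B τ φ).transpose := by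
  have hdet := (Matrix.isUnit_iff_isUnit_det φ).mp hφ
  rw [← Matrix.transpose_nonsing_inv, ← Matrix.transpose_nonsing_inv, dmat_transpose,
    dmat_inv τ hφ, ← Matrix.transpose_mul, neg_mul, Matrix.transpose_neg,
    Matrix.nonsing_inv_nonsing_inv _ hdet, Matrix.nonsing_inv_mul_cancel_right _ _ hdet]

lemma trace_inv_transpose (τ σ : Derivation K B B) {φ ψ : Matrix (Fin n) (Fin n) B}
    (hφ : IsUnit φ) (hψ : IsUnit ψ) :
    Matrix.trace ((ψ.transpose⁻¹)⁻¹ * (φ.transpose⁻¹)⁻¹ * dmat K B τ φ.transpose⁻¹ *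
        dmat K B σ ψ.transpose⁻¹) =
      Matrix.trace (ψ⁻¹ * φ⁻¹ * dmat K B τ φ * dmat K B σ ψ) := by
  have hdet := (Matrix.isUnit_iff_isUnit_det ψ).mp hψ
  rw [mul_assoc (ψ.transpose⁻¹)⁻¹, inv_mul_dmat_inv_transpose τ hφ,
    ← Matrix.transpose_nonsing_inv, ← Matrix.transpose_nonsing_inv,
    Matrix.nonsing_inv_nonsing_inv _ hdet, dmat_transpose, dmat_inv σ hψ, ← Matrix.transpose_neg,
    ← Matrix.transpose_mul, ← Matrix.transpose_mul, Matrix.trace_transpose,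
    Matrix.trace_mul_comm]
  simp only [neg_mul, mul_neg, neg_neg, ← mul_assoc]
  rw [Matrix.mul_nonsing_inv_cancel_right _ _ hdet, Matrix.trace_mul_comm]
  simp only [← mul_assoc]

lemma trace_neg_transpose_mul₃ (M N P : Matrix (Fin n) (Fin n) B) :
    Matrix.trace (-M.transpose * -N.transpose * -P.transpose) = -Matrix.trace (P * N * M) := by
  rw [neg_mul_neg, mul_neg, ← Matrix.transpose_mul, ← Matrix.transpose_mul, Matrix.trace_neg,
    Matrix.trace_transpose, mul_assoc]

end

/-- Section 3.5: `p(φ) = p(φ^{−1,t})`, so the Pontryagin–Atiyah–Chern–Simons class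
satisfies `p(E) = p(E*)`. -/
theorem p_of_inverse_transpose {n : ℕ} (hn : 0 < n)
    (φ ψ : Matrix (Fin n) (Fin n) A) (hφ : IsUnit φ) (hψ : IsUnit ψ) :
    (∀ τ₁ τ₂ τ₃ : Derivation k A A,
        p3 k A (φ.transpose)⁻¹ τ₁ τ₂ τ₃ = p3 k A φ τ₁ τ₂ τ₃) ∧
    (∀ τ σ : Derivation k A A,
        P2 k A (φ.transpose)⁻¹ (ψ.transpose)⁻¹ τ σ = P2 k A φ ψ τ σ) := by
  refine ⟨fun τ₁ τ₂ τ₃ => ?_, fun τ σ => ?_⟩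
  · unfold p3
    congr 1
    rw [← Equiv.sum_comp (Equiv.mulRight (Equiv.swap (0 : Fin 3) 2))]
    refine Finset.sum_congr rfl fun π _ => ?_
    have h : Equiv.swap (0 : Fin 3) 2 1 = 1 := by decide
    simp only [inv_mul_dmat_inv_transpose _ hφ, Equiv.coe_mulRight, Equiv.Perm.mul_apply,
      Equiv.swap_apply_left, Equiv.swap_apply_right, h, trace_neg_transpose_mul₃,
      Equiv.Perm.sign_mul,
      Equiv.Perm.sign_swap (show (0 : Fin 3) ≠ 2 by decide)]
    simp
  · unfold P2
    rw [trace_inv_transpose τ σ hφ hψ, trace_inv_transpose σ τ hφ hψ]
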